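/- arXiv:2108.03096 — 8 statements merged into one kernel-verified Lean document; each statement's English description precedes it below -/
import Mathlib

section
/- For any subset R ⊆ V₁ × V₂, the topological closure of R with respect to the product topology T_{E₁} ⊗ T_{E₂} (= T_{E₁×E₂}) equals E₁* R (E₂*)ᵒ, that is, cl(R) = {(a,c) ∈ V₁×V₂ : ∃ (a',c') ∈ R with a E₁* a' and c E₂* c'}. -/
/-- Afterset `O R = {c : ∃ o ∈ O, o R c}`. -/
def afterset {V : Type*} (R : V → V → Prop) (O : Set V) : Set V := {c | ∃ o ∈ O, R o c}

/-- Foreset `R B = {a : ∃ b ∈ B, a R b}`. -/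
def foreset {V : Type*} (R : V → V → Prop) (B : Set V) : Set V := {a | ∃ b ∈ B, R a b}

/-- The collection `T_R = {O ⊆ V : O R ⊆ O}`. -/
def TRel {V : Type*} (R : V → V → Prop) : Set (Set V) := {O | afterset R O ⊆ O}

/-- The topology on `V` whose open sets are exactly the members of `TRel E`. -/
def alexTop {V : Type*} (E : V → V → Prop) : TopologicalSpace V where
  IsOpen O := afterset E O ⊆ O
  isOpen_univ := fun c _ => Set.mem_univ c
  isOpen_inter := by
    rintro O U hO hU c ⟨o, ⟨hoO, hoU⟩, hoc⟩
    exact ⟨hO ⟨o, hoO, hoc⟩, hU ⟨o, hoU, hoc⟩⟩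
  isOpen_sUnion := by
    rintro S hS c ⟨o, ho, hoc⟩
    obtain ⟨t, htS, hot⟩ := Set.mem_sUnion.mp ho
    exact Set.mem_sUnion.mpr ⟨t, htS, hS t htS ⟨o, hot, hoc⟩⟩

theorem upset_mem_TRel {V : Type*} (E : V → V → Prop) (a : V) :
    {b | Relation.ReflTransGen E a b} ∈ TRel E := by
  rintro c ⟨o, ho, hoc⟩
  exact Relation.ReflTransGen.tail ho hoc

theorem mem_of_reflTransGen {V : Type*} {E : V → V → Prop} {O : Set V} (hO : O ∈ TRel E)
    {a b : V} (h : Relation.ReflTransGen E a b) (ha : a ∈ O) : b ∈ O := by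
  induction h with
  | refl => exact ha
  | tail _ hbc ih => exact hO ⟨_, ih, hbc⟩

/-- for `R ⊆ V₁ × V₂`, the closure of `R` in the product topology
`T_{E₁} ⊗ T_{E₂}` equals `E₁* R (E₂*)ᵒ`, i.e. the set of pairs `(a, c)` such that
there is `(a', c') ∈ R` with `a E₁* a'` and `c E₂* c'`. -/
theorem closure_prod_alexTop (V₁ V₂ : Type*) [Nonempty V₁] [Nonempty V₂]
    (E₁ : V₁ → V₁ → Prop) (E₂ : V₂ → V₂ → Prop) (R : Set (V₁ × V₂)) :
    @closure (V₁ × V₂)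
        (TopologicalSpace.generateFrom
          {s : Set (V₁ × V₂) | ∃ O₁ O₂, O₁ ∈ TRel E₁ ∧ O₂ ∈ TRel E₂ ∧ s = O₁ ×ˢ O₂}) R
      = {p : V₁ × V₂ | ∃ q ∈ R,
          Relation.ReflTransGen E₁ p.1 q.1 ∧ Relation.ReflTransGen E₂ p.2 q.2} := by
  letI : TopologicalSpace (V₁ × V₂) := TopologicalSpace.generateFrom
    {s : Set (V₁ × V₂) | ∃ O₁ O₂, O₁ ∈ TRel E₁ ∧ O₂ ∈ TRel E₂ ∧ s = O₁ ×ˢ O₂}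
  ext p
  refine Iff.trans mem_closure_iff ?_
  constructor
  · intro h
    obtain ⟨q, ⟨hq1, hq2⟩, hqR⟩ := h
      ({a | Relation.ReflTransGen E₁ p.1 a} ×ˢ {c | Relation.ReflTransGen E₂ p.2 c})
      (TopologicalSpace.isOpen_generateFrom_of_mem
        ⟨_, _, upset_mem_TRel E₁ p.1, upset_mem_TRel E₂ p.2, rfl⟩)
      ⟨Relation.ReflTransGen.refl, Relation.ReflTransGen.refl⟩
    exact ⟨q, hqR, hq1, hq2⟩
  · rintro ⟨q, hqR, h1, h2⟩ o ho hp
    refine ⟨q, ?_, hqR⟩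
    have ho' : TopologicalSpace.GenerateOpen
      {s : Set (V₁ × V₂) | ∃ O₁ O₂, O₁ ∈ TRel E₁ ∧ O₂ ∈ TRel E₂ ∧ s = O₁ ×ˢ O₂} o := ho
    clear ho
    induction ho' with
    | basic s hs =>
      obtain ⟨O₁, O₂, hO₁, hO₂, rfl⟩ := hs
      exact ⟨mem_of_reflTransGen hO₁ h1 hp.1, mem_of_reflTransGen hO₂ h2 hp.2⟩
    | univ => trivial
    | inter s t _ _ ihs iht => exact ⟨ihs hp.1, iht hp.2⟩
    | sUnion S _ ih =>
      obtain ⟨t, htS, hpt⟩ := hp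
      exact ⟨t, htS, ih t htS hpt⟩
end

section
/- For a subset V' ⊆ V, the following statements are equivalent: (1) V' is a connected component of the topological space (V, T_E); (2) V' is a connected component of (V, T_{Eᵒ}); (3) V' is a connected component of (V, T_{E ∪ Eᵒ}); (4) V' is an equivalence class of the equivalence relation (E ∪ Eᵒ)*. -/
/-- `s` is a connected component of `(V, t)`: a maximal connected subset. -/
def IsConnCompOf {V : Type*} (t : TopologicalSpace V) (s : Set V) : Prop :=
  @IsConnected V t s ∧ ∀ u : Set V, @IsConnected V t u → s ⊆ u → u = s

theorem connComp_aux {V : Type*} (E : V → V → Prop) (x : V) :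
    @connectedComponent V (alexTop E) x =
      {y | Relation.ReflTransGen (fun a b => E a b ∨ E b a) x y} := by
  letI := alexTop E
  apply Set.Subset.antisymm
  · apply IsClopen.connectedComponent_subset
    · constructor
      · rw [← isOpen_compl_iff]
        rintro c ⟨o, ho, hoc⟩ hc
        exact ho (Relation.ReflTransGen.tail hc (Or.inr hoc))
      · rintro c ⟨o, ho, hoc⟩
        exact Relation.ReflTransGen.tail ho (Or.inl hoc)
    · exact Relation.ReflTransGen.refl
  · have key : ∀ a b, E a b → connectedComponent a = connectedComponent b := by
      intro a b hab
      have h : a ∈ closure ({b} : Set V) := by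
        rw [mem_closure_iff]
        intro o ho hao
        exact ⟨b, ho ⟨a, hao, hab⟩, rfl⟩
      have h2 : a ∈ connectedComponent b :=
        isPreconnected_singleton.closure.subset_connectedComponent
          (subset_closure (Set.mem_singleton b)) h
      exact (connectedComponent_eq h2).symm
    intro y hy
    have : connectedComponent x = connectedComponent y := by
      induction hy with
      | refl => rfl
      | tail _ h ih =>
        rcases h with h | h
        · exact ih.trans (key _ _ h)
        · exact ih.trans (key _ _ h).symm
    rw [this]
    exact mem_connectedComponent

theorem isConnCompOf_aux {V : Type*} (E : V → V → Prop) (V' : Set V) :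
    IsConnCompOf (alexTop E) V' ↔
      ∃ x : V, V' = {y | Relation.ReflTransGen (fun a b => E a b ∨ E b a) x y} := by
  simp only [← connComp_aux]
  letI := alexTop E
  constructor
  · rintro ⟨h, hmax⟩
    obtain ⟨x, hx⟩ := h.nonempty
    exact ⟨x, (hmax _ isConnected_connectedComponent
      (h.isPreconnected.subset_connectedComponent hx)).symm⟩
  · rintro ⟨x, rfl⟩
    exact ⟨isConnected_connectedComponent, fun u hu hs => Set.Subset.antisymm
      (hu.isPreconnected.subset_connectedComponent (hs mem_connectedComponent)) hs⟩

/-- for `V' ⊆ V`, the following are equivalent: `V'` is a connected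
component of `(V, T_E)`; of `(V, T_{Eᵒ})`; of `(V, T_{E ∪ Eᵒ})`; and `V'` is an
equivalence class of the equivalence relation `(E ∪ Eᵒ)*`. -/
theorem connComp_alexTop_tfae (V : Type*) [Nonempty V] (E : V → V → Prop) (V' : Set V) :
    List.TFAE
      [IsConnCompOf (alexTop E) V',
       IsConnCompOf (alexTop (flip E)) V',
       IsConnCompOf (alexTop (fun a b => E a b ∨ flip E a b)) V',
       ∃ x : V, V' = {y | Relation.ReflTransGen (fun a b => E a b ∨ E b a) x y}] := by
  have h2 : (fun a b => flip E a b ∨ flip E b a) = (fun a b => E a b ∨ E b a) := by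
    funext a b
    exact propext or_comm
  have h3 : (fun a b => (E a b ∨ flip E a b) ∨ (E b a ∨ flip E b a)) =
      (fun a b => E a b ∨ E b a) := by
    funext a b
    simp only [flip]
    apply propext
    tauto
  have e1 := isConnCompOf_aux E V'
  have e2 := isConnCompOf_aux (flip E) V'
  have e3 := isConnCompOf_aux (fun a b => E a b ∨ flip E a b) V'
  rw [h2] at e2
  rw [h3] at e3
  tfae_have 1 ↔ 4 := e1
  tfae_have 2 ↔ 4 := e2
  tfae_have 3 ↔ 4 := e3
  tfae_finish
end

section
/- For all vertices b, c ∈ V∖W, b and c are t-separated given W if and only if b and c are d-separated given W; that is, cl_W(R^W{b}) ∩ cl_W(R^W{c}) = ∅ if and only if ¬(b A^W c). -/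
/-- The subdiagonal relation `Δ_S`. -/
def diag {V : Type*} (S : Set V) : V → V → Prop := fun a b => a = b ∧ a ∈ S

/-- Conditional parental relation `E^W = Δ_{V∖W} E`. -/
def condParent {V : Type*} (E : V → V → Prop) (W : Set V) : V → V → Prop :=
  Relation.Comp (diag Wᶜ) E

/-- Conditional ascendent relation `B^W = E (E^W)*`. -/
def condAsc {V : Type*} (E : V → V → Prop) (W : Set V) : V → V → Prop :=
  Relation.Comp E (Relation.ReflTransGen (condParent E W))

/-- `B^{-W} = (B^W)ᵒ`. -/
def condAscConv {V : Type*} (E : V → V → Prop) (W : Set V) : V → V → Prop :=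
  flip (condAsc E W)

/-- Conditional common cause relation `K^W = ((E^W)⁺)ᵒ (E^W)⁺`. -/
def condK {V : Type*} (E : V → V → Prop) (W : Set V) : V → V → Prop :=
  Relation.Comp (flip (Relation.TransGen (condParent E W))) (Relation.TransGen (condParent E W))

/-- Conditional cousinhood relation `C^W = (Δ_W K^W Δ_W)⁺ ∪ Δ_W`. -/
def condC {V : Type*} (E : V → V → Prop) (W : Set V) : V → V → Prop := fun a b =>
  Relation.TransGen (Relation.Comp (Relation.Comp (diag W) (condK E W)) (diag W)) a b ∨
    diag W a b

/-- Conditional active relation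
`A^W = Δ ∪ B^W ∪ B^{-W} ∪ K^W ∪ (B^W ∪ K^W) C^W (B^{-W} ∪ K^W)`. -/
def condA {V : Type*} (E : V → V → Prop) (W : Set V) : V → V → Prop := fun a b =>
  a = b ∨ condAsc E W a b ∨ condAscConv E W a b ∨ condK E W a b ∨
    Relation.Comp
      (Relation.Comp (fun x y => condAsc E W x y ∨ condK E W x y) (condC E W))
      (fun x y => condAscConv E W x y ∨ condK E W x y) a b

/-- The relation `R^W = Δ ∪ C^W (B^{-W} ∪ K^W)`. -/
def condR {V : Type*} (E : V → V → Prop) (W : Set V) : V → V → Prop := fun a b =>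
  a = b ∨
    Relation.Comp (condC E W) (fun x y => condAscConv E W x y ∨ condK E W x y) a b

/-- Conditional topological closure `cl_W(B) = (E^W)* B`. -/
def clW {V : Type*} (E : V → V → Prop) (W : Set V) (B : Set V) : Set V :=
  foreset (Relation.ReflTransGen (condParent E W)) B

open Relation in
theorem aux_asc {V : Type*} {E : V → V → Prop} {W : Set V} {b w : V} (hb : b ∉ W) :
    condAsc E W b w ↔ TransGen (condParent E W) b w := by
  rw [TransGen.head'_iff]
  constructor
  · rintro ⟨d, h1, h2⟩
    exact ⟨d, ⟨b, ⟨rfl, hb⟩, h1⟩, h2⟩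
  · rintro ⟨d, ⟨_, ⟨rfl, _⟩, h1⟩, h2⟩
    exact ⟨d, h1, h2⟩

theorem aux_Ksymm {V : Type*} {E : V → V → Prop} {W : Set V} {x y : V}
    (h : condK E W x y) : condK E W y x := by
  obtain ⟨s, h1, h2⟩ := h
  exact ⟨s, h2, h1⟩

open Relation in
theorem aux_M {V : Type*} {E : V → V → Prop} {W : Set V} {b w : V} (hb : b ∉ W) :
    (condAscConv E W w b ∨ condK E W w b) ↔
      ∃ s, ReflTransGen (condParent E W) s b ∧ TransGen (condParent E W) s w := by
  constructor
  · rintro (h | ⟨s, h1, h2⟩)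
    · exact ⟨b, .refl, (aux_asc hb).1 h⟩
    · exact ⟨s, h2.to_reflTransGen, h1⟩
  · rintro ⟨s, h1, h2⟩
    rcases reflTransGen_iff_eq_or_transGen.1 h1 with rfl | h1
    · exact Or.inl ((aux_asc hb).2 h2)
    · exact Or.inr ⟨s, h2, h1⟩

theorem aux_M' {V : Type*} {E : V → V → Prop} {W : Set V} {b w : V} :
    (condAsc E W b w ∨ condK E W b w) ↔ (condAscConv E W w b ∨ condK E W w b) :=
  or_congr Iff.rfl ⟨aux_Ksymm, aux_Ksymm⟩

open Relation in
theorem aux_Csymm {V : Type*} {E : V → V → Prop} {W : Set V} {x y : V}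
    (h : condC E W x y) : condC E W y x := by
  rcases h with h | ⟨rfl, h⟩
  · left
    induction h with
    | single h =>
      obtain ⟨_, ⟨_, ⟨rfl, h1⟩, h2⟩, ⟨rfl, h3⟩⟩ := h
      exact .single ⟨_, ⟨_, ⟨rfl, h3⟩, aux_Ksymm h2⟩, ⟨rfl, h1⟩⟩
    | tail _ h ih =>
      obtain ⟨_, ⟨_, ⟨rfl, h1⟩, h2⟩, ⟨rfl, h3⟩⟩ := h
      exact .head ⟨_, ⟨_, ⟨rfl, h3⟩, aux_Ksymm h2⟩, ⟨rfl, h1⟩⟩ ih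
  · exact Or.inr ⟨rfl, h⟩

theorem aux_Ctrans {V : Type*} {E : V → V → Prop} {W : Set V} {x y z : V}
    (h : condC E W x y) (h' : condC E W y z) : condC E W x z := by
  rcases h with h | ⟨rfl, h⟩
  · rcases h' with h' | ⟨rfl, _⟩
    · exact Or.inl (h.trans h')
    · exact Or.inl h
  · exact h'

open Relation in
theorem aux_Cmem {V : Type*} {E : V → V → Prop} {W : Set V} {x y : V}
    (h : condC E W x y) : x ∈ W := by
  rcases h with h | ⟨_, h⟩
  · obtain ⟨_, ⟨_, ⟨_, ⟨_, h1⟩, _⟩, _⟩, _⟩ := TransGen.head'_iff.1 h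
    exact h1
  · exact h

open Relation in
theorem aux_W {V : Type*} {E : V → V → Prop} {W : Set V} {x y : V} (hx : x ∈ W)
    (h : ReflTransGen (condParent E W) x y) : x = y := by
  rcases ReflTransGen.cases_head h with h | ⟨_, ⟨_, ⟨_, h1⟩, _⟩, _⟩
  · exact h
  · exact absurd hx h1

open Relation in
theorem aux_one {V : Type*} {E : V → V → Prop} {W : Set V} {v b y : V} (hb : b ∉ W)
    (hy : y ∈ W) (h1 : ReflTransGen (condParent E W) v b)
    (h2 : ReflTransGen (condParent E W) v y) :
    condAscConv E W y b ∨ condK E W y b := by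
  rw [aux_M hb]
  rcases reflTransGen_iff_eq_or_transGen.1 h2 with rfl | h2
  · exact absurd (aux_W hy h1 ▸ hy) hb
  · exact ⟨v, h1, h2⟩

/-- for vertices `b, c ∈ V∖W`, `b` and `c` are t-separated given `W`
iff they are d-separated given `W`:
`cl_W(R^W{b}) ∩ cl_W(R^W{c}) = ∅ ↔ ¬(b A^W c)`. -/
theorem tSep_iff_dSep (V : Type*) [Nonempty V] (E : V → V → Prop) (W : Set V)
    (b c : V) (hb : b ∉ W) (hc : c ∉ W) :
    clW E W (foreset (condR E W) {b}) ∩ clW E W (foreset (condR E W) {c}) = ∅ ↔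
      ¬ condA E W b c := by
  rw [← not_iff_not, not_not, ← ne_eq, ← Set.nonempty_iff_ne_empty]
  constructor
  · rintro ⟨v, ⟨x, ⟨_, rfl, hx⟩, hvx⟩, ⟨y, ⟨_, rfl, hy⟩, hvy⟩⟩
    rcases hx with rfl | ⟨w₁, hC₁, hM₁⟩
    · rcases hy with rfl | ⟨w₂, hC₂, hM₂⟩
      · rcases Relation.reflTransGen_iff_eq_or_transGen.1 hvx with rfl | hx'
        · rcases Relation.reflTransGen_iff_eq_or_transGen.1 hvy with rfl | hy'
          · exact Or.inl rfl
          · exact Or.inr (Or.inl ((aux_asc hb).2 hy'))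
        · rcases Relation.reflTransGen_iff_eq_or_transGen.1 hvy with rfl | hy'
          · exact Or.inr (Or.inr (Or.inl ((aux_asc hc).2 hx')))
          · exact Or.inr (Or.inr (Or.inr (Or.inl ⟨v, hx', hy'⟩)))
      · exact Or.inr (Or.inr (Or.inr (Or.inr
          ⟨w₂, ⟨y, aux_M'.2 (aux_one hb (aux_Cmem hC₂) hvx hvy), hC₂⟩, hM₂⟩)))
    · rcases hy with rfl | ⟨w₂, hC₂, hM₂⟩
      · exact Or.inr (Or.inr (Or.inr (Or.inr
          ⟨x, ⟨w₁, aux_M'.2 hM₁, aux_Csymm hC₁⟩, aux_one hc (aux_Cmem hC₁) hvy hvx⟩)))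
      · have hxW := aux_Cmem hC₁
        have hyW := aux_Cmem hC₂
        have hxy : condC E W x y := by
          rcases Relation.reflTransGen_iff_eq_or_transGen.1 hvx with rfl | hx'
          · exact Or.inr ⟨aux_W hxW hvy, hxW⟩
          · rcases Relation.reflTransGen_iff_eq_or_transGen.1 hvy with rfl | hy'
            · exact Or.inr ⟨(aux_W hyW hvx).symm, hxW⟩
            · exact Or.inl (.single ⟨y, ⟨x, ⟨rfl, hxW⟩, ⟨v, hx', hy'⟩⟩, ⟨rfl, hyW⟩⟩)
        exact Or.inr (Or.inr (Or.inr (Or.inr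
          ⟨w₂, ⟨w₁, aux_M'.2 hM₁, aux_Ctrans (aux_Csymm hC₁) (aux_Ctrans hxy hC₂)⟩, hM₂⟩)))
  · rintro (rfl | h | h | ⟨s, h1, h2⟩ | ⟨w₂, ⟨w₁, hM₁, hC⟩, hM₂⟩)
    · exact ⟨b, ⟨b, ⟨b, rfl, Or.inl rfl⟩, .refl⟩, ⟨b, ⟨b, rfl, Or.inl rfl⟩, .refl⟩⟩
    · exact ⟨b, ⟨b, ⟨b, rfl, Or.inl rfl⟩, .refl⟩,
        ⟨c, ⟨c, rfl, Or.inl rfl⟩, ((aux_asc hb).1 h).to_reflTransGen⟩⟩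
    · exact ⟨c, ⟨b, ⟨b, rfl, Or.inl rfl⟩, ((aux_asc hc).1 h).to_reflTransGen⟩,
        ⟨c, ⟨c, rfl, Or.inl rfl⟩, .refl⟩⟩
    · exact ⟨s, ⟨b, ⟨b, rfl, Or.inl rfl⟩, Relation.TransGen.to_reflTransGen h1⟩,
        ⟨c, ⟨c, rfl, Or.inl rfl⟩, h2.to_reflTransGen⟩⟩
    · exact ⟨w₁, ⟨w₁, ⟨b, rfl, Or.inr ⟨w₁, Or.inr ⟨rfl, aux_Cmem hC⟩, aux_M'.1 hM₁⟩⟩, .refl⟩,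
        ⟨w₁, ⟨c, rfl, Or.inr ⟨w₂, hC, hM₂⟩⟩, .refl⟩⟩
end

section
/- Let B, C ⊆ V be subsets of vertices with B ∩ C = ∅, B ∩ W = ∅ and C ∩ W = ∅. Then the following are equivalent: (1) for all b ∈ B and c ∈ C, b and c are t-separated given W; (2) there exists a splitting of W into two disjoint subsets W_B and W_C (W_B ∩ W_C = ∅ and W_B ∪ W_C = W) such that cl_W(B ∪ W_B) ∩ cl_W(C ∪ W_C) = ∅. -/
/-- Two vertices whose conditional closures meet. -/
def conn {V : Type*} (E : V → V → Prop) (W : Set V) (x y : V) : Prop :=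
  ∃ z, Relation.ReflTransGen (condParent E W) z x ∧ Relation.ReflTransGen (condParent E W) z y

theorem conn_symm {V : Type*} {E : V → V → Prop} {W : Set V} {x y : V}
    (h : conn E W x y) : conn E W y x := by
  obtain ⟨z, h1, h2⟩ := h
  exact ⟨z, h2, h1⟩

theorem eq_of_rtg {V : Type*} {E : V → V → Prop} {W : Set V} {x y : V} (hx : x ∈ W)
    (h : Relation.ReflTransGen (condParent E W) x y) : y = x := by
  rcases Relation.ReflTransGen.cases_head h with h | ⟨c, ⟨d, ⟨rfl, hd⟩, _⟩, _⟩
  · exact h.symm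
  · exact absurd hx hd

theorem conn_of_K {V : Type*} {E : V → V → Prop} {W : Set V} {x y : V}
    (h : condK E W x y) : conn E W x y := by
  obtain ⟨z, h1, h2⟩ := h
  exact ⟨z, Relation.TransGen.to_reflTransGen h1, h2.to_reflTransGen⟩

theorem K_of_conn {V : Type*} {E : V → V → Prop} {W : Set V} {x y : V} (hx : x ∈ W) (hy : y ∈ W)
    (h : conn E W x y) : x = y ∨ condK E W x y := by
  obtain ⟨z, h1, h2⟩ := h
  rcases Relation.reflTransGen_iff_eq_or_transGen.1 h1 with rfl | h1'
  · exact Or.inl (eq_of_rtg hx h2).symm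
  rcases Relation.reflTransGen_iff_eq_or_transGen.1 h2 with rfl | h2'
  · exact Or.inl (eq_of_rtg hy h1)
  exact Or.inr ⟨z, h1', h2'⟩

theorem conn_iff {V : Type*} {E : V → V → Prop} {W : Set V} {u b : V} (hu : u ∈ W) (hb : b ∉ W) :
    conn E W u b ↔ (condAscConv E W u b ∨ condK E W u b) := by
  constructor
  · rintro ⟨z, h1, h2⟩
    rcases Relation.reflTransGen_iff_eq_or_transGen.1 h1 with rfl | h1'
    · exact absurd (eq_of_rtg hu h2 ▸ hu) hb
    rcases Relation.reflTransGen_iff_eq_or_transGen.1 h2 with rfl | h2'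
    · left
      obtain ⟨c, ⟨d, ⟨rfl, hd⟩, hE⟩, hc⟩ := Relation.TransGen.head'_iff.1 h1'
      exact ⟨c, hE, hc⟩
    exact Or.inr ⟨z, h1', h2'⟩
  · rintro (⟨c, hE, hc⟩ | h)
    · exact ⟨b, Relation.ReflTransGen.head ⟨b, ⟨rfl, hb⟩, hE⟩ hc, Relation.ReflTransGen.refl⟩
    · exact conn_of_K h

theorem condC_mem {V : Type*} {E : V → V → Prop} {W : Set V} {x u : V}
    (h : condC E W x u) : x ∈ W ∧ u ∈ W := by
  rcases h with h | ⟨rfl, h⟩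
  · constructor
    · obtain ⟨c, ⟨d, ⟨e, ⟨_, he⟩, _⟩, _⟩, _⟩ := Relation.TransGen.head'_iff.1 h
      exact he
    · obtain ⟨c, _, ⟨d, _, ⟨rfl, he⟩⟩⟩ := Relation.TransGen.tail'_iff.1 h
      exact he
  · exact ⟨h, h⟩

theorem condC_closed {V : Type*} {E : V → V → Prop} {W S : Set V}
    (hS : ∀ x ∈ S, ∀ y ∈ W, conn E W x y → y ∈ S) {x u : V}
    (h : condC E W x u) (hu : u ∈ S) : x ∈ S := by
  rcases h with h | ⟨rfl, h⟩
  · have key : ∀ a c, Relation.Comp (Relation.Comp (diag W) (condK E W)) (diag W) a c →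
        c ∈ S → a ∈ S := by
      rintro a c ⟨d, ⟨e, ⟨rfl, ha⟩, hK⟩, ⟨rfl, _⟩⟩ hc
      exact hS _ hc _ ha (conn_symm (conn_of_K hK))
    induction h using Relation.TransGen.head_induction_on with
    | single h => exact key _ _ h hu
    | head h _ ih => exact key _ _ h ih
  · exact hu

theorem condR_closed {V : Type*} {E : V → V → Prop} {W S : Set V}
    (hS : ∀ x ∈ S, ∀ y ∈ W, conn E W x y → y ∈ S) {x b : V} (hbW : b ∉ W)
    (h : condR E W x b) (hb : b ∈ S) : x ∈ S := by
  rcases h with rfl | ⟨u, hC, h⟩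
  · exact hb
  · have hu := (condC_mem hC).2
    exact condC_closed hS hC (hS _ hb _ hu (conn_symm ((conn_iff hu hbW).2 h)))

theorem condR_extend {V : Type*} {E : V → V → Prop} {W : Set V} {x y b : V} (hbW : b ∉ W)
    (h : condR E W x b) (hy : y ∈ W) (hc : conn E W x y) : condR E W y b := by
  rcases h with rfl | ⟨u, hC, h⟩
  · exact Or.inr ⟨y, Or.inr ⟨rfl, hy⟩, (conn_iff hy hbW).1 (conn_symm hc)⟩
  · have hx := (condC_mem hC).1
    rcases K_of_conn hy hx (conn_symm hc) with rfl | hK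
    · exact Or.inr ⟨u, hC, h⟩
    · have hs : Relation.Comp (Relation.Comp (diag W) (condK E W)) (diag W) y x :=
        ⟨x, ⟨y, ⟨rfl, hy⟩, hK⟩, ⟨rfl, hx⟩⟩
      refine Or.inr ⟨u, Or.inl ?_, h⟩
      rcases hC with hC | ⟨rfl, _⟩
      · exact Relation.TransGen.head hs hC
      · exact Relation.TransGen.single hs

theorem cl_disj_iff {V : Type*} {E : V → V → Prop} {W S T : Set V} :
    clW E W S ∩ clW E W T = ∅ ↔ ∀ x ∈ S, ∀ y ∈ T, ¬ conn E W x y := by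
  rw [Set.eq_empty_iff_forall_notMem]
  constructor
  · rintro h x hx y hy ⟨z, h1, h2⟩
    exact h z ⟨⟨x, hx, h1⟩, ⟨y, hy, h2⟩⟩
  · rintro h z ⟨⟨x, hx, h1⟩, ⟨y, hy, h2⟩⟩
    exact h x hx y hy ⟨z, h1, h2⟩

/-- for `B, C ⊆ V` with `B ∩ C = ∅`, `B ∩ W = ∅`, `C ∩ W = ∅`:
all pairs `b ∈ B`, `c ∈ C` are t-separated given `W` iff there is a splitting
`W = W_B ⊔ W_C` with `cl_W(B ∪ W_B) ∩ cl_W(C ∪ W_C) = ∅`. -/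
theorem tSep_subsets_iff_splitting (V : Type*) [Nonempty V] (E : V → V → Prop)
    (W B C : Set V) (hBC : B ∩ C = ∅) (hBW : B ∩ W = ∅) (hCW : C ∩ W = ∅) :
    (∀ b ∈ B, ∀ c ∈ C,
        clW E W (foreset (condR E W) {b}) ∩ clW E W (foreset (condR E W) {c}) = ∅) ↔
      ∃ WB WC : Set V, WB ∩ WC = ∅ ∧ WB ∪ WC = W ∧
        clW E W (B ∪ WB) ∩ clW E W (C ∪ WC) = ∅ := by
  have hB : ∀ b ∈ B, b ∉ W := fun b hb hw => by
    have : b ∈ B ∩ W := ⟨hb, hw⟩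
    simp [hBW] at this
  have hC : ∀ b ∈ C, b ∉ W := fun b hb hw => by
    have : b ∈ C ∩ W := ⟨hb, hw⟩
    simp [hCW] at this
  simp only [cl_disj_iff]
  constructor
  · intro h
    refine ⟨{w ∈ W | ∃ b ∈ B, condR E W w b}, {w ∈ W | ¬ ∃ b ∈ B, condR E W w b}, ?_, ?_, ?_⟩
    · ext w; simp only [Set.mem_inter_iff, Set.mem_ofPred_eq, Set.mem_empty_iff_false]; generalize (∃ b ∈ B, condR E W w b) = P; clear h; tauto
    · ext w; simp only [Set.mem_union, Set.mem_ofPred_eq]; generalize (∃ b ∈ B, condR E W w b) = P; clear h; tauto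
    · intro x hx y hy hc
      have hx' : ∃ b ∈ B, condR E W x b := by
        rcases hx with hx | hx
        · exact ⟨x, hx, Or.inl rfl⟩
        · exact hx.2
      obtain ⟨b, hb, hxb⟩ := hx'
      rcases hy with hy | hy
      · exact h b hb y hy x ⟨b, rfl, hxb⟩ y ⟨y, rfl, Or.inl rfl⟩ hc
      · exact hy.2 ⟨b, hb, condR_extend (hB b hb) hxb hy.1 hc⟩
  · rintro ⟨WB, WC, -, rfl, h⟩ b hb c hc x ⟨_, rfl, hx⟩ y ⟨_, rfl, hy⟩
    refine h x (condR_closed ?_ (hB _ hb) hx (Or.inl hb)) y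
      (condR_closed ?_ (hC _ hc) hy (Or.inl hc))
    · intro p hp q hq hpq
      rcases hq with hq | hq
      · exact Or.inr hq
      · exact absurd hpq (h p hp q (Or.inr hq))
    · intro p hp q hq hpq
      rcases hq with hq | hq
      · exact absurd (conn_symm hpq) (h q (Or.inr hq) p hp)
      · exact Or.inr hq
end

section
/- Let W', W'' ⊆ W be two subsets included in two distinct equivalence classes of the partial equivalence relation C^W (i.e., any two elements of W' are C^W-related, any two elements of W'' are C^W-related, and no element of W' is C^W-related to an element of W''). Then cl_W(W') ∩ cl_W(W'') = ∅. -/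
/-- if `W', W'' ⊆ W` are included in two distinct equivalence classes
of the partial equivalence relation `C^W` (any two elements of `W'` are `C^W`-related,
any two elements of `W''` are `C^W`-related, and no element of `W'` is `C^W`-related
to an element of `W''`), then `cl_W(W') ∩ cl_W(W'') = ∅`. -/
theorem clW_disjoint_of_distinct_classes (V : Type*) [Nonempty V] (E : V → V → Prop)
    (W W' W'' : Set V) (hW' : W' ⊆ W) (hW'' : W'' ⊆ W)
    (h1 : ∀ a ∈ W', ∀ b ∈ W', condC E W a b)
    (h2 : ∀ a ∈ W'', ∀ b ∈ W'', condC E W a b)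
    (h3 : ∀ a ∈ W', ∀ b ∈ W'', ¬ condC E W a b) :
    clW E W W' ∩ clW E W W'' = ∅ := by
  rw [Set.eq_empty_iff_forall_notMem]
  rintro x ⟨⟨a, ha, hxa⟩, ⟨b, hb, hxb⟩⟩
  apply h3 a ha b hb
  -- a point of `W` has no outgoing conditional arrow
  have key : ∀ y, x ∈ W → Relation.ReflTransGen (condParent E W) x y → x = y := by
    intro y hx h
    rcases Relation.ReflTransGen.cases_head h with h | ⟨c, ⟨d, ⟨_, hd⟩, _⟩, _⟩
    · exact h
    · exact absurd hx hd
  by_cases hx : x ∈ W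
  · have e1 := key a hx hxa
    have e2 := key b hx hxb
    exact Or.inr ⟨e1.symm.trans e2, hW' ha⟩
  · have t : ∀ y ∈ W, Relation.ReflTransGen (condParent E W) x y →
        Relation.TransGen (condParent E W) x y := by
      intro y hy h
      rcases Relation.reflTransGen_iff_eq_or_transGen.mp h with h | h
      · exact absurd (h ▸ hy) hx
      · exact h
    exact Or.inl (Relation.TransGen.single
      ⟨b, ⟨a, ⟨rfl, hW' ha⟩, ⟨x, t a (hW' ha) hxa, t b (hW'' hb) hxb⟩⟩, ⟨rfl, hW'' hb⟩⟩)
end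

section
/- Let W = W' ⊔ W'' be a splitting of W into two disjoint subsets (W' ∩ W'' = ∅, W' ∪ W'' = W) such that cl_W(W') ∩ cl_W(W'') = ∅. Then there do not exist w' ∈ W' and w'' ∈ W'' with w' C^W w''; in other words, no element of W' is in the same C^W-equivalence class as an element of W''. -/
/-- if `W = W' ⊔ W''` is a splitting (`W' ∩ W'' = ∅`, `W' ∪ W'' = W`)
with `cl_W(W') ∩ cl_W(W'') = ∅`, then no `w' ∈ W'` is `C^W`-related to a `w'' ∈ W''`. -/
theorem no_cousin_across_splitting (V : Type*) [Nonempty V] (E : V → V → Prop)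
    (W W' W'' : Set V) (hdisj : W' ∩ W'' = ∅) (hunion : W' ∪ W'' = W)
    (hcl : clW E W W' ∩ clW E W W'' = ∅) :
    ¬ ∃ w' ∈ W', ∃ w'' ∈ W'', condC E W w' w'' := by
  have step : ∀ a b, a ∈ W' →
      Relation.Comp (Relation.Comp (diag W) (condK E W)) (diag W) a b → b ∈ W' := by
    rintro a b ha ⟨c, ⟨d, ⟨rfl, -⟩, ⟨e, hea, hec⟩⟩, ⟨rfl, hcW⟩⟩
    rw [← hunion] at hcW
    rcases hcW with h | h
    · exact h
    · exfalso
      have hmem : e ∈ clW E W W' ∩ clW E W W'' :=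
        ⟨⟨a, ha, Relation.TransGen.to_reflTransGen hea⟩,
          ⟨c, h, Relation.TransGen.to_reflTransGen hec⟩⟩
      rw [hcl] at hmem
      exact hmem
  have key : ∀ a b, a ∈ W' → Relation.TransGen
      (Relation.Comp (Relation.Comp (diag W) (condK E W)) (diag W)) a b → b ∈ W' := by
    intro a b ha h
    induction h with
    | single h => exact step _ _ ha h
    | tail _ h ih => exact step _ _ ih h
  rintro ⟨a, ha, b, hb, hab⟩
  have hbW : b ∈ W' := by
    rcases hab with h | ⟨rfl, -⟩
    · exact key a b ha h
    · exact ha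
  have hmem : b ∈ W' ∩ W'' := ⟨hbW, hb⟩
  rw [hdisj] at hmem
  exact hmem
end

section
/- The following identity between composed relations holds: Δ_{V∖W} (Δ ∪ (B^W ∪ K^W) C^W) ((E^W)*)ᵒ (E^W)* C^W ((E^W)*)ᵒ (E^W)* (Δ ∪ C^W (B^{-W} ∪ K^W)) Δ_{V∖W} = Δ_{V∖W} (B^W ∪ K^W) C^W (B^{-W} ∪ K^W) Δ_{V∖W}. -/
local infixr:80 " ⬝ " => Relation.Comp

open Relation in
theorem aux_head {V : Type*} {E : V → V → Prop} {W : Set V} {x y : V}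
    (h : ReflTransGen (condParent E W) x y) :
    x = y ∨ (x ∉ W ∧ TransGen (condParent E W) x y ∧ condAsc E W x y) := by
  rcases ReflTransGen.cases_head h with h | ⟨c, ⟨d, ⟨rfl, hx⟩, hE⟩, hc⟩
  · exact Or.inl h
  · exact Or.inr ⟨hx, TransGen.head' ⟨_, ⟨rfl, hx⟩, hE⟩ hc, _, hE, hc⟩

open Relation in
theorem aux_out {V : Type*} {E : V → V → Prop} {W : Set V} {x z c : V}
    (hx : x ∉ W) (hc : c ∈ W) (h1 : ReflTransGen (condParent E W) z x)
    (h2 : ReflTransGen (condParent E W) z c) : condAsc E W x c ∨ condK E W x c := by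
  rcases aux_head h1 with rfl | ⟨hz, h1, -⟩
  · rcases aux_head h2 with rfl | ⟨-, -, h⟩
    · exact absurd hc hx
    · exact Or.inl h
  · rcases aux_head h2 with rfl | ⟨-, h, -⟩
    · exact absurd hc hz
    · exact Or.inr ⟨z, h1, h⟩

open Relation in
theorem aux_in {V : Type*} {E : V → V → Prop} {W : Set V} {b z c : V}
    (hb : b ∈ W) (hc : c ∈ W) (h1 : ReflTransGen (condParent E W) z b)
    (h2 : ReflTransGen (condParent E W) z c) : condC E W b c := by
  rcases aux_head h1 with rfl | ⟨hz, h1, -⟩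
  · rcases aux_head h2 with rfl | ⟨h, -, -⟩
    · exact Or.inr ⟨rfl, hb⟩
    · exact absurd hb h
  · rcases aux_head h2 with rfl | ⟨-, h, -⟩
    · exact absurd hc hz
    · exact Or.inl (TransGen.single ⟨c, ⟨b, ⟨rfl, hb⟩, z, h1, h⟩, rfl, hc⟩)

open Relation in
theorem aux_mem {V : Type*} {E : V → V → Prop} {W : Set V} {a b : V}
    (h : condC E W a b) : a ∈ W ∧ b ∈ W := by
  rcases h with h | ⟨rfl, h⟩
  · constructor
    · obtain ⟨_, ⟨_, ⟨_, ⟨rfl, hm⟩, _⟩, _⟩, _⟩ := TransGen.head'_iff.1 h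
      exact hm
    · obtain ⟨_, _, ⟨_, _, ⟨rfl, hm⟩⟩⟩ := TransGen.tail'_iff.1 h
      exact hm
  · exact ⟨h, h⟩

theorem aux_trans {V : Type*} {E : V → V → Prop} {W : Set V} {a b c : V}
    (h : condC E W a b) (hbc : condC E W b c) : condC E W a c := by
  rcases h with h | ⟨rfl, h⟩
  · rcases hbc with hbc | ⟨rfl, hbc⟩
    · exact Or.inl (h.trans hbc)
    · exact Or.inl h
  · exact hbc

/-- `Δ_{V∖W} (Δ ∪ (B^W ∪ K^W) C^W) ((E^W)*)ᵒ (E^W)* C^W ((E^W)*)ᵒ (E^W)* (Δ ∪ C^W (B^{-W} ∪ K^W)) Δ_{V∖W}`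
`= Δ_{V∖W} (B^W ∪ K^W) C^W (B^{-W} ∪ K^W) Δ_{V∖W}`. -/
theorem relation_identity_17 (V : Type*) [Nonempty V] (E : V → V → Prop) (W : Set V) :
    (diag Wᶜ ⬝
      (fun a b => a = b ∨
        Relation.Comp (fun x y => condAsc E W x y ∨ condK E W x y) (condC E W) a b) ⬝
      flip (Relation.ReflTransGen (condParent E W)) ⬝
      Relation.ReflTransGen (condParent E W) ⬝
      condC E W ⬝
      flip (Relation.ReflTransGen (condParent E W)) ⬝
      Relation.ReflTransGen (condParent E W) ⬝
      (fun a b => a = b ∨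
        Relation.Comp (condC E W) (fun x y => condAscConv E W x y ∨ condK E W x y) a b) ⬝
      diag Wᶜ)
    =
    (diag Wᶜ ⬝
      (fun x y => condAsc E W x y ∨ condK E W x y) ⬝
      condC E W ⬝
      (fun x y => condAscConv E W x y ∨ condK E W x y) ⬝
      diag Wᶜ) := by
  funext a g
  apply propext
  constructor
  · rintro ⟨_, ⟨rfl, ha⟩, b, hab, z, hzb, c, hzc, d, hcd, e, hed, f, hef, g', hfg, rfl, hg⟩
    obtain ⟨hc, hd⟩ := aux_mem hcd
    have hL : ∃ c', (condAsc E W a c' ∨ condK E W a c') ∧ condC E W c' d := by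
      rcases hab with rfl | ⟨c', h1, h2⟩
      · exact ⟨c, aux_out ha hc hzb hzc, hcd⟩
      · exact ⟨c', h1, aux_trans h2 (aux_trans (aux_in (aux_mem h2).2 hc hzb hzc) hcd)⟩
    obtain ⟨c', h1, h2⟩ := hL
    rcases hfg with rfl | ⟨d', h3, h4⟩
    · refine ⟨a, ⟨rfl, ha⟩, c', h1, d, h2, f, ?_, rfl, hg⟩
      rcases aux_out hg hd hef hed with h | ⟨k, hk1, hk2⟩
      · exact Or.inl h
      · exact Or.inr ⟨k, hk2, hk1⟩
    · exact ⟨a, ⟨rfl, ha⟩, c', h1, d',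
        aux_trans h2 (aux_trans (aux_in hd (aux_mem h3).1 hed hef) h3), g', h4, rfl, hg⟩
  · rintro ⟨_, ⟨rfl, ha⟩, c, hac, d, hcd, g', hdg, rfl, hg⟩
    obtain ⟨hc, hd⟩ := aux_mem hcd
    exact ⟨a, ⟨rfl, ha⟩, c, Or.inr ⟨c, hac, Or.inr ⟨rfl, hc⟩⟩, c, .refl, c, .refl, d, hcd,
      d, .refl, d, .refl, g', Or.inr ⟨d, Or.inr ⟨rfl, hd⟩, hdg⟩, rfl, hg⟩
end

section
/- The following identity between composed relations holds: (R^{-W} ((E^W)*)ᵒ (E^W)* R^W) ∪ (R^{-W} B^{-W} Δ_W) ∪ (Δ_W B^W R^W) = A^W ∪ R^{-W} ∪ R^W, where R^W = Δ ∪ C^W (B^{-W} ∪ K^W) and R^{-W} = (R^W)ᵒ = Δ ∪ (B^W ∪ K^W) C^W. -/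
local infixr:80 " ⬝ " => Relation.Comp

section Helpers
variable {V : Type*} {E : V → V → Prop} {W : Set V}

theorem aux_K_symm {a b : V} (h : condK E W a b) : condK E W b a := by
  obtain ⟨c, h1, h2⟩ := h
  exact ⟨c, h2, h1⟩

theorem aux_step {a b : V} (ha : a ∈ W) (h : condK E W a b) (hb : b ∈ W) :
    Relation.Comp (Relation.Comp (diag W) (condK E W)) (diag W) a b :=
  ⟨b, ⟨a, ⟨rfl, ha⟩, h⟩, rfl, hb⟩

theorem aux_step_inv {a b : V}
    (h : Relation.Comp (Relation.Comp (diag W) (condK E W)) (diag W) a b) :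
    a ∈ W ∧ condK E W a b ∧ b ∈ W := by
  obtain ⟨c, ⟨d, ⟨rfl, ha⟩, h⟩, rfl, hb⟩ := h
  exact ⟨ha, h, hb⟩

theorem aux_C_of_K {a b : V} (ha : a ∈ W) (h : condK E W a b) (hb : b ∈ W) : condC E W a b :=
  Or.inl (.single (aux_step ha h hb))

theorem aux_C_refl {a : V} (ha : a ∈ W) : condC E W a a := Or.inr ⟨rfl, ha⟩

theorem aux_C_symm {a b : V} (h : condC E W a b) : condC E W b a := by
  rcases h with h | ⟨rfl, h⟩
  · left
    induction h with
    | single h =>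
      obtain ⟨h1, h2, h3⟩ := aux_step_inv h
      exact .single (aux_step h3 (aux_K_symm h2) h1)
    | tail _ h ih =>
      obtain ⟨h1, h2, h3⟩ := aux_step_inv h
      exact .head (aux_step h3 (aux_K_symm h2) h1) ih
  · exact aux_C_refl h

theorem aux_C_left {a b : V} (h : condC E W a b) : a ∈ W := by
  rcases h with h | ⟨rfl, h⟩
  · induction h with
    | single h => exact (aux_step_inv h).1
    | tail _ _ ih => exact ih
  · exact h

theorem aux_C_trans {a b c : V} (h : condC E W a b) (h' : condC E W b c) : condC E W a c := by
  rcases h with h | ⟨rfl, h⟩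
  · rcases h' with h' | ⟨rfl, h'⟩
    · exact Or.inl (h.trans h')
    · exact Or.inl h
  · exact h'

theorem aux_tg_left {a b : V} (h : Relation.TransGen (condParent E W) a b) :
    a ∉ W ∧ condAsc E W a b := by
  obtain ⟨c, ⟨d, ⟨rfl, ha⟩, h⟩, h'⟩ := Relation.TransGen.head'_iff.1 h
  exact ⟨ha, c, h, h'⟩

theorem aux_tg_of_asc {a b : V} (ha : a ∉ W) (h : condAsc E W a b) :
    Relation.TransGen (condParent E W) a b := by
  obtain ⟨c, h, h'⟩ := h
  exact Relation.TransGen.head'_iff.2 ⟨c, ⟨a, ⟨rfl, ha⟩, h⟩, h'⟩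

theorem aux_swap {a b : V} (h : condAsc E W a b ∨ condK E W a b) :
    condAscConv E W b a ∨ condK E W b a := h.imp id aux_K_symm

theorem aux_swap' {a b : V} (h : condAscConv E W a b ∨ condK E W a b) :
    condAsc E W b a ∨ condK E W b a := h.imp id aux_K_symm

/-- Common (possibly trivial) conditional ancestors, split into cases. -/
theorem aux_split {c x y : V} (h1 : Relation.ReflTransGen (condParent E W) c x)
    (h2 : Relation.ReflTransGen (condParent E W) c y) :
    x = y ∨ (x ∉ W ∧ condAsc E W x y) ∨ (y ∉ W ∧ condAsc E W y x) ∨ condK E W x y := by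
  rcases Relation.reflTransGen_iff_eq_or_transGen.1 h1 with rfl | h1
  · rcases Relation.reflTransGen_iff_eq_or_transGen.1 h2 with rfl | h2
    · exact Or.inl rfl
    · exact Or.inr (Or.inl (aux_tg_left h2))
  · rcases Relation.reflTransGen_iff_eq_or_transGen.1 h2 with rfl | h2
    · exact Or.inr (Or.inr (Or.inl (aux_tg_left h1)))
    · exact Or.inr (Or.inr (Or.inr ⟨c, h1, h2⟩))

theorem aux_A {a b x y : V} (h1 : condAsc E W a x ∨ condK E W a x) (h2 : condC E W x y)
    (h3 : condAsc E W b y ∨ condK E W b y) : condA E W a b :=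
  Or.inr (Or.inr (Or.inr (Or.inr ⟨y, ⟨x, h1, h2⟩, aux_swap h3⟩)))

end Helpers

/-- `(R^{-W} ((E^W)*)ᵒ (E^W)* R^W) ∪ (R^{-W} B^{-W} Δ_W) ∪ (Δ_W B^W R^W) = A^W ∪ R^{-W} ∪ R^W`,
where `R^W = Δ ∪ C^W (B^{-W} ∪ K^W)` and `R^{-W} = (R^W)ᵒ`. -/
theorem relation_identity_19 (V : Type*) [Nonempty V] (E : V → V → Prop) (W : Set V) :
    (fun a b =>
      (flip (condR E W) ⬝
        flip (Relation.ReflTransGen (condParent E W)) ⬝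
        Relation.ReflTransGen (condParent E W) ⬝
        condR E W) a b ∨
      (flip (condR E W) ⬝ condAscConv E W ⬝ diag W) a b ∨
      (diag W ⬝ condAsc E W ⬝ condR E W) a b)
    = (fun a b => condA E W a b ∨ flip (condR E W) a b ∨ condR E W a b) := by
  funext a b
  apply propext
  constructor
  · rintro (⟨x, hx, c, hcx, y, hcy, hy⟩ | ⟨x, hx, y, hxy, rfl, hy⟩ | ⟨x, ⟨rfl, ha⟩, y, hay, hy⟩)
    · have hs := aux_split hcx hcy
      rcases hx with rfl | ⟨w, hxw, hwa⟩
      · rcases hy with rfl | ⟨v, hyv, hvb⟩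
        · rcases hs with h | h | h | h
          · exact Or.inl (Or.inl h)
          · exact Or.inl (Or.inr (Or.inl h.2))
          · exact Or.inl (Or.inr (Or.inr (Or.inl h.2)))
          · exact Or.inl (Or.inr (Or.inr (Or.inr (Or.inl h))))
        · rcases hs with rfl | h | h | h
          · exact Or.inr (Or.inr (Or.inr ⟨v, hyv, hvb⟩))
          · exact Or.inl (aux_A (Or.inl h.2) hyv (aux_swap' hvb))
          · exact absurd (aux_C_left hyv) h.1
          · exact Or.inl (aux_A (Or.inr h) hyv (aux_swap' hvb))
      · have hwx := aux_C_symm hxw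
        have hxW := aux_C_left hxw
        rcases hy with rfl | ⟨v, hyv, hvb⟩
        · rcases hs with rfl | h | h | h
          · exact Or.inr (Or.inl (Or.inr ⟨w, hxw, hwa⟩))
          · exact absurd hxW h.1
          · exact Or.inl (aux_A (aux_swap' hwa) hwx (Or.inl h.2))
          · exact Or.inl (aux_A (aux_swap' hwa) hwx (Or.inr (aux_K_symm h)))
        · have hyW := aux_C_left hyv
          rcases hs with rfl | h | h | h
          · exact Or.inl (aux_A (aux_swap' hwa) (aux_C_trans hwx hyv) (aux_swap' hvb))
          · exact absurd hxW h.1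
          · exact absurd hyW h.1
          · exact Or.inl (aux_A (aux_swap' hwa)
              (aux_C_trans hwx (aux_C_trans (aux_C_of_K hxW h hyW) hyv)) (aux_swap' hvb))
    · rcases hx with rfl | ⟨w, hxw, hwa⟩
      · exact Or.inl (Or.inr (Or.inr (Or.inl hxy)))
      · exact Or.inl (aux_A (aux_swap' hwa) (aux_C_symm hxw) (Or.inl hxy))
    · rcases hy with rfl | ⟨v, hyv, hvb⟩
      · exact Or.inl (Or.inr (Or.inl hay))
      · exact Or.inl (aux_A (Or.inl hay) hyv (aux_swap' hvb))
  · rintro ((rfl | h | h | ⟨c, h1, h2⟩ | ⟨w, ⟨x, hax, hxw⟩, hwb⟩) | h | h)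
    · exact Or.inl ⟨a, Or.inl rfl, a, .refl, a, .refl, Or.inl rfl⟩
    · by_cases ha : a ∈ W
      · exact Or.inr (Or.inr ⟨a, ⟨rfl, ha⟩, b, h, Or.inl rfl⟩)
      · exact Or.inl ⟨a, Or.inl rfl, a, .refl, b, (aux_tg_of_asc ha h).to_reflTransGen, Or.inl rfl⟩
    · by_cases hb : b ∈ W
      · exact Or.inr (Or.inl ⟨a, Or.inl rfl, b, h, rfl, hb⟩)
      · exact Or.inl ⟨a, Or.inl rfl, b, (aux_tg_of_asc hb h).to_reflTransGen, b, .refl, Or.inl rfl⟩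
    · exact Or.inl ⟨a, Or.inl rfl, c, h1.to_reflTransGen, b, h2.to_reflTransGen, Or.inl rfl⟩
    · exact Or.inl ⟨x, Or.inr ⟨x, aux_C_refl (aux_C_left hxw), aux_swap hax⟩, x, .refl, x, .refl,
        Or.inr ⟨w, hxw, hwb⟩⟩
    · exact Or.inl ⟨b, h, b, .refl, b, .refl, Or.inl rfl⟩
    · exact Or.inl ⟨a, Or.inl rfl, a, .refl, a, .refl, h⟩
end
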